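/- (Virial-type inequality along characteristics, Proposition 2.6.) Let ε>0, γ>0, and let E:ℝ₊×ℝ²→ℝ² be continuous. Suppose X,V,ξ,η:ℝ₊→ℝ² are C¹ curves with X(t)≠ξ(t) for all t≥0, satisfying the ODEs Ẋ(t)=V(t)/ε, V̇(t)=V(t)^⊥/ε²+(1/ε)(E(t,X(t))+γ(X(t)−ξ(t))/|X(t)−ξ(t)|²), ξ̇(t)=η(t)/ε, η̇(t)=γ(η(t)^⊥/ε²+E(t,ξ(t))/ε). Then the function t↦|X(t)−ξ(t)| is twice differentiable and for all t≥0: γ/|X(t)−ξ(t)| ≤ ε²(d²/dt²)|X(t)−ξ(t)| + |V(t)−γη(t)|/ε + |E(t,X(t))| + γ|E(t,ξ(t))|. -/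

import Mathlib

open MeasureTheory Real Filter
open scoped RealInnerProductSpace ENNReal Topology Classical

noncomputable section

/-- The plane `ℝ²`. -/
abbrev E2 : Type := EuclideanSpace ℝ (Fin 2)

/-- The rotation by π/2: `(x₁,x₂)^⊥ = (-x₂,x₁)`. -/
def perp (x : E2) : E2 := !₂[-(x 1), x 0]

/-- The symmetrized kernel `H_Φ`. -/
def Hker (Φ : E2 → ℝ) (x y : E2) : ℝ :=
  if x = y then 0 else ⟪perp (x - y), gradient Φ x - gradient Φ y⟫ / ‖x - y‖ ^ 2

/-- The symmetrized bilinear form `H_Φ[ρ,μ]`. -/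
def Hform (Φ : E2 → ℝ) (ρ μ : Measure E2) : ℝ :=
  (1 / 2) * ∫ x, (∫ y, Hker Φ x y ∂μ) ∂ρ

/-- Entry `(i,j)` of the Jacobian matrix `D∇^⊥Φ` of `∇^⊥Φ = (-∂₂Φ, ∂₁Φ)`. -/
def DperpGrad (Φ : E2 → ℝ) (i j : Fin 2) (x : E2) : ℝ :=
  fderiv ℝ (fun y => perp (gradient Φ y) i) x (EuclideanSpace.single j 1)

lemma perp_norm_aux (x : E2) : ‖perp x‖ = ‖x‖ := by
  rw [EuclideanSpace.norm_eq, EuclideanSpace.norm_eq]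
  congr 1
  simp [perp, Fin.sum_univ_two]
  ring

lemma perp_lin_aux (x y : E2) (c : ℝ) : perp (x - c • y) = perp x - c • perp y := by
  ext i
  fin_cases i <;> simp [perp] <;> ring

/-- **Proposition 2.6 (virial-type inequality along characteristics).** Along characteristics of
(VP_ε) which never meet the point charge, the function `t ↦ |X(t)-ξ(t)|` is twice differentiable
on `ℝ₊` and `γ/|X-ξ| ≤ ε² (d²/dt²)|X-ξ| + |V-γη|/ε + |E(t,X)| + γ|E(t,ξ)|`. -/
theorem stmt5 (ε γ : ℝ) (hε : 0 < ε) (hγ : 0 < γ)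
    (Efield : ℝ → E2 → E2) (hE : Continuous fun p : ℝ × E2 => Efield p.1 p.2)
    (X V ξ η : ℝ → E2)
    (hsep : ∀ t, 0 ≤ t → X t ≠ ξ t)
    (hX : ∀ t, 0 ≤ t → HasDerivWithinAt X (ε⁻¹ • V t) (Set.Ici 0) t)
    (hV : ∀ t, 0 ≤ t → HasDerivWithinAt V
      ((ε ^ 2)⁻¹ • perp (V t) +
        ε⁻¹ • (Efield t (X t) + (γ / ‖X t - ξ t‖ ^ 2) • (X t - ξ t))) (Set.Ici 0) t)
    (hξ : ∀ t, 0 ≤ t → HasDerivWithinAt ξ (ε⁻¹ • η t) (Set.Ici 0) t)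
    (hη : ∀ t, 0 ≤ t → HasDerivWithinAt η
      (γ • ((ε ^ 2)⁻¹ • perp (η t) + ε⁻¹ • Efield t (ξ t))) (Set.Ici 0) t) :
    ∃ r' r'' : ℝ → ℝ,
      (∀ t, 0 ≤ t → HasDerivWithinAt (fun s => ‖X s - ξ s‖) (r' t) (Set.Ici 0) t) ∧
      (∀ t, 0 ≤ t → HasDerivWithinAt r' (r'' t) (Set.Ici 0) t) ∧
      ∀ t, 0 ≤ t →
        γ / ‖X t - ξ t‖ ≤ ε ^ 2 * r'' t + ‖V t - γ • η t‖ / ε +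
          ‖Efield t (X t)‖ + γ * ‖Efield t (ξ t)‖ := by
  have hr : ∀ t, 0 ≤ t → 0 < ‖X t - ξ t‖ := fun t ht =>
    norm_pos_iff.mpr (sub_ne_zero.mpr (hsep t ht))
  have hD : ∀ t, 0 ≤ t →
      HasDerivWithinAt (fun s => X s - ξ s) (ε⁻¹ • (V t - η t)) (Set.Ici 0) t := by
    intro t ht
    have h := (hX t ht).sub (hξ t ht)
    rw [← smul_sub] at h
    exact h
  obtain ⟨A, hA⟩ : ∃ A : ℝ → E2, ∀ t, A t = (ε ^ 2)⁻¹ • perp (V t - γ • η t) +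
      ε⁻¹ • (Efield t (X t) - γ • Efield t (ξ t) + (γ / ‖X t - ξ t‖ ^ 2) • (X t - ξ t)) :=
    ⟨_, fun _ => rfl⟩
  have hW : ∀ t, 0 ≤ t → HasDerivWithinAt (fun s => V s - η s) (A t) (Set.Ici 0) t := by
    intro t ht
    have h := (hV t ht).sub (hη t ht)
    refine h.congr_deriv ?_
    rw [hA, perp_lin_aux]
    module
  have hN : ∀ t, 0 ≤ t → HasDerivWithinAt (fun s => ‖X s - ξ s‖)
      (⟪X t - ξ t, ε⁻¹ • (V t - η t)⟫ / ‖X t - ξ t‖) (Set.Ici 0) t := by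
    intro t ht
    have h1 := ((hD t ht).norm_sq).sqrt (pow_pos (hr t ht) 2).ne'
    simp only [Real.sqrt_sq (norm_nonneg _)] at h1
    refine h1.congr_deriv ?_
    have := (hr t ht).ne'
    field_simp
  have hN2 : ∀ t, 0 ≤ t → HasDerivWithinAt
      (fun t => ⟪X t - ξ t, ε⁻¹ • (V t - η t)⟫ / ‖X t - ξ t‖) _ (Set.Ici 0) t :=
    fun t ht => ((hD t ht).inner ℝ ((hW t ht).const_smul ε⁻¹)).div (hN t ht) (hr t ht).ne'
  refine ⟨_, _, hN, hN2, ?_⟩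
  intro t ht
  have hr0 := hr t ht
  have e1 : ⟪X t - ξ t, A t⟫ = (ε ^ 2)⁻¹ * ⟪X t - ξ t, perp (V t - γ • η t)⟫ +
      ε⁻¹ * (⟪X t - ξ t, Efield t (X t)⟫ - γ * ⟪X t - ξ t, Efield t (ξ t)⟫ + γ) := by
    rw [hA]
    simp only [inner_add_right, inner_sub_right, real_inner_smul_right]
    have h0 := real_inner_self_eq_norm_sq (X t - ξ t)
    rw [inner_sub_right] at h0
    rw [h0]
    field_simp
  have c1 := neg_le_of_abs_le (abs_real_inner_le_norm (X t - ξ t) (perp (V t - γ • η t)))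
  have c2 := neg_le_of_abs_le (abs_real_inner_le_norm (X t - ξ t) (Efield t (X t)))
  have c3 := le_of_abs_le (abs_real_inner_le_norm (X t - ξ t) (Efield t (ξ t)))
  have c4 := real_inner_mul_inner_self_le (X t - ξ t) (V t - η t)
  rw [perp_norm_aux] at c1
  simp only [Pi.smul_apply, real_inner_smul_right, real_inner_smul_left, e1]
  rw [real_inner_self_eq_norm_sq, real_inner_self_eq_norm_sq] at c4
  rw [real_inner_self_eq_norm_sq]
  generalize ⟪X t - ξ t, perp (V t - γ • η t)⟫ = p at *
  generalize ⟪X t - ξ t, Efield t (X t)⟫ = q at *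
  generalize ⟪X t - ξ t, Efield t (ξ t)⟫ = u at *
  generalize ⟪X t - ξ t, V t - η t⟫ = w at *
  generalize ‖X t - ξ t‖ = r at *
  generalize ‖V t - γ • η t‖ = a at *
  generalize ‖Efield t (X t)‖ = b at *
  generalize ‖Efield t (ξ t)‖ = c at *
  generalize ‖V t - η t‖ = d at *
  have key : 0 ≤ (r ^ 2 * d ^ 2 - w * w) / r ^ 3 + (p + r * a) / (ε * r) + (q + r * b) / r
      + γ * (r * c - u) / r := by
    have h1 : 0 ≤ (r ^ 2 * d ^ 2 - w * w) / r ^ 3 := div_nonneg (by linarith) (by positivity)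
    have h2 : 0 ≤ (p + r * a) / (ε * r) := div_nonneg (by linarith) (by positivity)
    have h3 : 0 ≤ (q + r * b) / r := div_nonneg (by linarith) (by positivity)
    have h4 : 0 ≤ γ * (r * c - u) / r :=
      div_nonneg (mul_nonneg hγ.le (by linarith)) (by positivity)
    linarith
  rw [← sub_nonneg]
  refine key.trans_eq ?_
  field_simp
  ring
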